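/- The following pointwise identities hold on ℝ: L_Q(iQ) = L_Q(ΛQ) = L_Q(∂ₓQ) = 0; L_Q(i·x·Q) = i·Q; L_Q(i·x²·Q) = 2i·x·Q; L_Q*(Q) = 0; L_Q*(i·Q) = −2i·∂ₓQ; L_Q*(x·Q) = Q; L_Q*(i·x·Q) = −2i·ΛQ. Consequently, for the linearized operator iℒ_Q := i·L_Q*∘L_Q one has the generalized-kernel relations iℒ_Q(iQ) = iℒ_Q(ΛQ) = iℒ_Q(∂ₓQ) = 0, iℒ_Q(i·x·Q) = 2·∂ₓQ, and iℒ_Q(i·x²·Q) = 4·ΛQ. -/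

import Mathlib

open MeasureTheory Filter Topology

/-- The Hilbert transform, realized as a principal-value integral:
`Hf(x) = (1/π) p.v. ∫ f(y)/(x-y) dy`. -/
noncomputable def pvH (f : ℝ → ℂ) (x : ℝ) : ℂ :=
  limUnder (nhdsWithin (0 : ℝ) (Set.Ioi 0)) fun ε : ℝ =>
    (Real.pi : ℂ)⁻¹ * ∫ y in {y : ℝ | ε < |x - y|}, f y / ((x - y : ℝ) : ℂ)

/-- The soliton `Q(x) = √2/√(1+x²)` (real-valued). -/
noncomputable def Qr (x : ℝ) : ℝ := Real.sqrt 2 / Real.sqrt (1 + x ^ 2)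

/-- The soliton, viewed as a complex-valued function. -/
noncomputable def Qc (x : ℝ) : ℂ := (Qr x : ℂ)

/-- `L_Q f = ∂ₓf + ½ H(Q²) f + Q · H(Re(Q f))`. -/
noncomputable def LQ (f : ℝ → ℂ) : ℝ → ℂ := fun x =>
  deriv f x + (1 / 2) * pvH (fun y => Qc y ^ 2) x * f x
    + Qc x * pvH (fun y => (((Qc y * f y).re : ℝ) : ℂ)) x

/-- `L_Q* f = −∂ₓf + ½ H(Q²) f − Q · H(Re(Q f))`. -/
noncomputable def LQs (f : ℝ → ℂ) : ℝ → ℂ := fun x =>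
  -deriv f x + (1 / 2) * pvH (fun y => Qc y ^ 2) x * f x
    - Qc x * pvH (fun y => (((Qc y * f y).re : ℝ) : ℂ)) x

/-- `ΛQ = ½ Q + x ∂ₓQ`. -/
noncomputable def LamQ : ℝ → ℂ := fun x => (1 / 2) * Qc x + (x : ℂ) * deriv Qc x

theorem setOf_lt_abs_sub (x ε : ℝ) :
    {y : ℝ | ε < |x - y|} = Set.Iio (x - ε) ∪ Set.Ioi (x + ε) := by
  ext y
  simp only [Set.mem_ofPred_eq, lt_abs, Set.mem_union, Set.mem_Iio, Set.mem_Ioi]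
  exact or_congr ⟨fun h => by linarith, fun h => by linarith⟩
    ⟨fun h => by linarith, fun h => by linarith⟩

theorem tendsto_half_log_sub_log (x : ℝ) {l : Filter ℝ}
    (hinv : Tendsto (fun y : ℝ => y⁻¹) l (𝓝 0)) (h0 : ∀ᶠ y in l, y ≠ 0) (hx : ∀ᶠ y in l, y ≠ x) :
    Tendsto (fun y : ℝ => Real.log (1 + y ^ 2) / 2 - Real.log (x - y)) l (𝓝 0) := by
  have h1 : Tendsto (fun y : ℝ => Real.log ((y⁻¹ ^ 2 + 1) / (x * y⁻¹ - 1) ^ 2) / 2) l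
      (𝓝 (Real.log ((0 ^ 2 + 1) / (x * 0 - 1) ^ 2) / 2)) := by
    refine Tendsto.div_const (Tendsto.log ?_ (by norm_num)) 2
    exact ((hinv.pow 2).add_const 1).div (((hinv.const_mul x).sub_const 1).pow 2) (by norm_num)
  have h2 : Real.log (((0 : ℝ) ^ 2 + 1) / (x * 0 - 1) ^ 2) / 2 = 0 := by norm_num
  rw [h2] at h1
  refine h1.congr' ?_
  filter_upwards [h0, hx] with y hy hyx
  have hxy : x - y ≠ 0 := sub_ne_zero.mpr hyx.symm
  have : (y⁻¹ ^ 2 + 1) / (x * y⁻¹ - 1) ^ 2 = (1 + y ^ 2) / (x - y) ^ 2 := by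
    have : x * y⁻¹ - 1 = (x - y) * y⁻¹ := by field_simp
    rw [this]
    field_simp
  rw [this, Real.log_div (by positivity) (by positivity), Real.log_pow]
  push_cast
  ring

/-- An antiderivative of `(a(1+y²) + c(1-y²) - 2by)/(1+y²)²`. -/
theorem hasDerivAt_arctan_add_rational (a b c y : ℝ) :
    HasDerivAt (fun y : ℝ => a * Real.arctan y + (b + c * y) / (1 + y ^ 2))
      ((a * (1 + y ^ 2) + c * (1 - y ^ 2) - 2 * b * y) / (1 + y ^ 2) ^ 2) y := by
  have hs : (1 + y ^ 2 : ℝ) ≠ 0 := by positivity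
  have h1 := (Real.hasDerivAt_arctan y).const_mul a
  have h2 : HasDerivAt (fun y : ℝ => b + c * y) c y := by
    simpa using ((hasDerivAt_id y).const_mul c).const_add b
  have h3 : HasDerivAt (fun y : ℝ => 1 + y ^ 2) (2 * y) y := by
    simpa using (hasDerivAt_pow 2 y).const_add 1
  refine (h1.add (h2.div h3 hs)).congr_deriv ?_
  field_simp
  ring

theorem hasDerivAt_half_log_sub_log {x y : ℝ} (h : y ≠ x) :
    HasDerivAt (fun y : ℝ => Real.log (1 + y ^ 2) / 2 - Real.log (x - y))
      ((1 + x * y) / ((1 + y ^ 2) * (x - y))) y := by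
  have hs : (1 + y ^ 2 : ℝ) ≠ 0 := by positivity
  have hxy : x - y ≠ 0 := sub_ne_zero.mpr h.symm
  have h3 : HasDerivAt (fun y : ℝ => 1 + y ^ 2) (2 * y) y := by
    simpa using (hasDerivAt_pow 2 y).const_add 1
  have h4 : HasDerivAt (fun y : ℝ => x - y) (-1) y := by
    simpa using (hasDerivAt_id y).const_sub x
  refine (((h3.log hs).div_const 2).sub (h4.log hxy)).congr_deriv ?_
  field_simp
  ring

theorem tendsto_rational_zero (b c : ℝ) {l : Filter ℝ}
    (hinv : Tendsto (fun y : ℝ => y⁻¹) l (𝓝 0)) (h0 : ∀ᶠ y in l, y ≠ 0) :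
    Tendsto (fun y : ℝ => (b + c * y) / (1 + y ^ 2)) l (𝓝 0) := by
  have h1 : Tendsto (fun y : ℝ => (b * y⁻¹ ^ 2 + c * y⁻¹) / (y⁻¹ ^ 2 + 1)) l
      (𝓝 ((b * 0 ^ 2 + c * 0) / (0 ^ 2 + 1))) :=
    (((hinv.pow 2).const_mul b).add (hinv.const_mul c)).div ((hinv.pow 2).add_const 1)
      (by norm_num)
  have h2 : (b * 0 ^ 2 + c * 0) / ((0 : ℝ) ^ 2 + 1) = 0 := by norm_num
  rw [h2] at h1
  refine h1.congr' ?_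
  filter_upwards [h0] with y hy
  field_simp

theorem integrableOn_kernel_add_rational (A a b c x : ℝ) {ε : ℝ} (hε : 0 < ε) :
    IntegrableOn (fun y : ℝ => A * ((1 + x * y) / ((1 + y ^ 2) * (x - y)))
      + (a * (1 + y ^ 2) + c * (1 - y ^ 2) - 2 * b * y) / (1 + y ^ 2) ^ 2)
      {y : ℝ | ε ≤ |x - y|} := by
  have hm : MeasurableSet {y : ℝ | ε ≤ |x - y|} :=
    measurableSet_le measurable_const (by fun_prop)
  refine Integrable.mono'
    (g := fun y => (|A| * (|x| + (1 + x ^ 2) / ε) + (|a| + |c| + |b|)) * (1 + y ^ 2)⁻¹)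
    (integrable_inv_one_add_sq.const_mul _).integrableOn
    (Measurable.aestronglyMeasurable (by fun_prop)) ?_
  filter_upwards [ae_restrict_mem hm] with y hy
  have hy : ε ≤ |x - y| := hy
  have hpos : 0 < |x - y| := hε.trans_le hy
  have hxy : x - y ≠ 0 := abs_pos.mp hpos
  have hs : (0 : ℝ) < 1 + y ^ 2 := by positivity
  have e1 : A * ((1 + x * y) / ((1 + y ^ 2) * (x - y)))
      + (a * (1 + y ^ 2) + c * (1 - y ^ 2) - 2 * b * y) / (1 + y ^ 2) ^ 2
      = (A * (-x + (1 + x ^ 2) / (x - y)) + (a + c * ((1 - y ^ 2) / (1 + y ^ 2))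
        - b * (2 * y / (1 + y ^ 2)))) * (1 + y ^ 2)⁻¹ := by
    field_simp
    ring
  rw [e1, norm_mul, Real.norm_eq_abs, Real.norm_eq_abs, abs_of_pos (inv_pos.mpr hs)]
  refine mul_le_mul_of_nonneg_right ?_ (inv_pos.mpr hs).le
  have b1 : |-x + (1 + x ^ 2) / (x - y)| ≤ |x| + (1 + x ^ 2) / ε := by
    refine (abs_add_le _ _).trans ?_
    rw [abs_neg, abs_div, abs_of_pos (by positivity : (0 : ℝ) < 1 + x ^ 2)]
    gcongr
  have b2 : |(1 - y ^ 2) / (1 + y ^ 2)| ≤ 1 := by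
    rw [abs_div, abs_of_pos hs, div_le_one hs, abs_le]
    constructor <;> nlinarith [sq_nonneg y]
  have b3 : |2 * y / (1 + y ^ 2)| ≤ 1 := by
    rw [abs_div, abs_of_pos hs, div_le_one hs, abs_le]
    constructor <;> nlinarith [sq_nonneg (y - 1), sq_nonneg (y + 1)]
  refine (abs_add_le _ _).trans (add_le_add ?_ ?_)
  · rw [abs_mul]; gcongr
  · refine (abs_sub _ _).trans (add_le_add ((abs_add_le _ _).trans (add_le_add le_rfl ?_)) ?_)
    · rw [abs_mul]; exact mul_le_of_le_one_right (abs_nonneg _) b2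
    · rw [abs_mul]; exact mul_le_of_le_one_right (abs_nonneg _) b3

/-- Hilbert transform of a function with a partial fraction decomposition over `(1+y²)²`. -/
theorem pvH_eq_of_partialFraction {f : ℝ → ℝ} {x : ℝ} (A a b c : ℝ)
    (hf : ∀ y, f y = A * (1 + x * y) / (1 + y ^ 2)
      + (x - y) * ((a * (1 + y ^ 2) + c * (1 - y ^ 2) - 2 * b * y) / (1 + y ^ 2) ^ 2)) :
    pvH (fun y => (f y : ℂ)) x = a := by
  set G : ℝ → ℝ := fun y => a * Real.arctan y + (b + c * y) / (1 + y ^ 2) with hG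
  set L : ℝ → ℝ := fun y => Real.log (1 + y ^ 2) / 2 - Real.log (x - y) with hL
  set k : ℝ → ℝ := fun y => A * ((1 + x * y) / ((1 + y ^ 2) * (x - y)))
      + (a * (1 + y ^ 2) + c * (1 - y ^ 2) - 2 * b * y) / (1 + y ^ 2) ^ 2 with hk
  have hder : ∀ y, y ≠ x → HasDerivAt (fun y => A * L y + G y) (k y) y := fun y hy =>
    ((hasDerivAt_half_log_sub_log hy).const_mul A).add (hasDerivAt_arctan_add_rational a b c y)
  have htop : Tendsto (fun y => A * L y + G y) atTop (𝓝 (a * (Real.pi / 2))) := by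
    have h := ((tendsto_half_log_sub_log x tendsto_inv_atTop_zero (eventually_ne_atTop 0)
      (eventually_ne_atTop x)).const_mul A).add
      (((tendsto_nhdsWithin_iff.mp Real.tendsto_arctan_atTop).1.const_mul a).add
        (tendsto_rational_zero b c tendsto_inv_atTop_zero (eventually_ne_atTop 0)))
    simpa using h
  have hbot : Tendsto (fun y => A * L y + G y) atBot (𝓝 (-(a * (Real.pi / 2)))) := by
    have h := ((tendsto_half_log_sub_log x tendsto_inv_atBot_zero (eventually_ne_atBot 0)
      (eventually_ne_atBot x)).const_mul A).add
      (((tendsto_nhdsWithin_iff.mp Real.tendsto_arctan_atBot).1.const_mul a).add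
        (tendsto_rational_zero b c tendsto_inv_atBot_zero (eventually_ne_atBot 0)))
    simpa using h
  have hint : ∀ ε : ℝ, 0 < ε → ∫ y in {y : ℝ | ε < |x - y|}, f y / (x - y)
      = a * Real.pi + (A * (Real.log (1 + (x - ε) ^ 2) / 2 - Real.log (1 + (x + ε) ^ 2) / 2)
        + (G (x - ε) - G (x + ε))) := by
    intro ε hε
    have hm : MeasurableSet {y : ℝ | ε < |x - y|} :=
      measurableSet_lt measurable_const (by fun_prop)
    have e1 : ∫ y in {y : ℝ | ε < |x - y|}, f y / (x - y) = ∫ y in {y : ℝ | ε < |x - y|}, k y := by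
      refine setIntegral_congr_fun hm fun y hy => ?_
      have hy : ε < |x - y| := hy
      have hxy : x - y ≠ 0 := abs_pos.mp (hε.trans hy)
      have hs : (1 + y ^ 2 : ℝ) ≠ 0 := by positivity
      simp only [hf y, hk]
      field_simp
    have hI := integrableOn_kernel_add_rational A a b c x hε
    have hI1 : IntegrableOn k (Set.Iic (x - ε)) := hI.mono_set fun y (hy : y ≤ x - ε) => by
      show ε ≤ |x - y|
      exact le_abs.mpr (Or.inl (by linarith))
    have hI2 : IntegrableOn k (Set.Ioi (x + ε)) := hI.mono_set fun y (hy : x + ε < y) => by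
      show ε ≤ |x - y|
      exact le_abs.mpr (Or.inr (by linarith))
    have e2 := integral_Ioi_of_hasDerivAt_of_tendsto' (a := x + ε)
      (fun y (hy : x + ε ≤ y) => hder y (by linarith)) hI2 htop
    have e3 := integral_Iic_of_hasDerivAt_of_tendsto' (a := x - ε)
      (fun y (hy : y ≤ x - ε) => hder y (by linarith)) hI1 hbot
    have hdisj : Disjoint (Set.Iio (x - ε)) (Set.Ioi (x + ε)) :=
      Set.disjoint_left.mpr fun y (h1 : y < x - ε) (h2 : x + ε < y) => by linarith
    rw [e1, setOf_lt_abs_sub x ε,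
      setIntegral_union hdisj measurableSet_Ioi (hI1.mono_set Set.Iio_subset_Iic_self) hI2,
      ← integral_Iic_eq_integral_Iio, e2, e3]
    have l1 : x - (x - ε) = ε := by ring
    have l2 : x - (x + ε) = -ε := by ring
    simp only [hL, l1, l2, Real.log_neg_eq_log]
    ring
  refine Tendsto.limUnder_eq ?_
  have hlim : Tendsto (fun ε : ℝ => Real.pi⁻¹ * (a * Real.pi
      + (A * (Real.log (1 + (x - ε) ^ 2) / 2 - Real.log (1 + (x + ε) ^ 2) / 2)
        + (G (x - ε) - G (x + ε))))) (𝓝[>] 0) (𝓝 a) := by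
    have hGc : Continuous G := continuous_iff_continuousAt.mpr fun y =>
      (hasDerivAt_arctan_add_rational a b c y).continuousAt
    have hlog : ∀ g : ℝ → ℝ, Continuous g → Continuous fun ε => Real.log (1 + g ε ^ 2) :=
      fun g hg => Continuous.log (by fun_prop) fun ε => by positivity
    have h1 := hlog (fun ε => x - ε) (by fun_prop)
    have h2 := hlog (fun ε => x + ε) (by fun_prop)
    have hc : Continuous (fun ε : ℝ => Real.pi⁻¹ * (a * Real.pi
      + (A * (Real.log (1 + (x - ε) ^ 2) / 2 - Real.log (1 + (x + ε) ^ 2) / 2)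
        + (G (x - ε) - G (x + ε))))) := by fun_prop
    have h := (hc.tendsto 0).mono_left (nhdsWithin_le_nhds (s := Set.Ioi 0))
    have e : Real.pi⁻¹ * (a * Real.pi
      + (A * (Real.log (1 + (x - 0) ^ 2) / 2 - Real.log (1 + (x + 0) ^ 2) / 2)
        + (G (x - 0) - G (x + 0)))) = a := by
      have := Real.pi_ne_zero
      simp only [sub_zero, add_zero, sub_self, mul_zero]
      field_simp
    rwa [e] at h
  refine ((Complex.continuous_ofReal.tendsto a).comp hlim).congr' ?_
  filter_upwards [self_mem_nhdsWithin] with ε hε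
  rw [Function.comp_apply, ← hint ε hε, Complex.ofReal_mul, Complex.ofReal_inv,
    ← integral_complex_ofReal]
  simp only [Complex.ofReal_div]

theorem pvH_zero (x : ℝ) : pvH (fun _ => ((0 : ℝ) : ℂ)) x = 0 := by
  simpa using pvH_eq_of_partialFraction (f := fun _ => 0) (x := x) 0 0 0 0 (by simp)

theorem pvH_two_div (x : ℝ) :
    pvH (fun y => ((2 / (1 + y ^ 2) : ℝ) : ℂ)) x = ((2 * x / (1 + x ^ 2) : ℝ) : ℂ) := by
  refine pvH_eq_of_partialFraction (2 / (1 + x ^ 2)) (2 * x / (1 + x ^ 2)) 0 0 fun y => ?_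
  have hx : (1 + x ^ 2 : ℝ) ≠ 0 := by positivity
  have hy : (1 + y ^ 2 : ℝ) ≠ 0 := by positivity
  field_simp
  ring

theorem pvH_two_mul_div (x : ℝ) :
    pvH (fun y => ((2 * y / (1 + y ^ 2) : ℝ) : ℂ)) x = ((-2 / (1 + x ^ 2) : ℝ) : ℂ) := by
  refine pvH_eq_of_partialFraction (2 * x / (1 + x ^ 2)) (-2 / (1 + x ^ 2)) 0 0 fun y => ?_
  have hx : (1 + x ^ 2 : ℝ) ≠ 0 := by positivity
  have hy : (1 + y ^ 2 : ℝ) ≠ 0 := by positivity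
  field_simp
  ring

theorem pvH_one_sub_sq_div (x : ℝ) :
    pvH (fun y => (((1 - y ^ 2) / (1 + y ^ 2) ^ 2 : ℝ) : ℂ)) x
      = ((2 * x / (1 + x ^ 2) ^ 2 : ℝ) : ℂ) := by
  refine pvH_eq_of_partialFraction ((1 - x ^ 2) / (1 + x ^ 2) ^ 2) (2 * x / (1 + x ^ 2) ^ 2)
    (-1 / (1 + x ^ 2)) (x / (1 + x ^ 2)) fun y => ?_
  have hx : (1 + x ^ 2 : ℝ) ≠ 0 := by positivity
  have hy : (1 + y ^ 2 : ℝ) ≠ 0 := by positivity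
  field_simp
  ring

theorem pvH_neg_two_mul_div_sq (x : ℝ) :
    pvH (fun y => ((-2 * y / (1 + y ^ 2) ^ 2 : ℝ) : ℂ)) x
      = (((1 - x ^ 2) / (1 + x ^ 2) ^ 2 : ℝ) : ℂ) := by
  refine pvH_eq_of_partialFraction (-2 * x / (1 + x ^ 2) ^ 2) ((1 - x ^ 2) / (1 + x ^ 2) ^ 2)
    (x / (1 + x ^ 2)) (1 / (1 + x ^ 2)) fun y => ?_
  have hx : (1 + x ^ 2 : ℝ) ≠ 0 := by positivity
  have hy : (1 + y ^ 2 : ℝ) ≠ 0 := by positivity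
  field_simp
  ring

theorem one_add_ofReal_sq_ne_zero (x : ℝ) : (1 + (x : ℂ) ^ 2) ≠ 0 := by
  have : (1 + x ^ 2 : ℝ) ≠ 0 := by positivity
  exact_mod_cast this

theorem Qr_sq (x : ℝ) : Qr x ^ 2 = 2 / (1 + x ^ 2) := by
  rw [Qr, div_pow, Real.sq_sqrt (by norm_num), Real.sq_sqrt (by positivity)]

theorem hasDerivAt_Qc (x : ℝ) : HasDerivAt Qc (-(x / (1 + x ^ 2)) * Qc x) x := by
  have hs : (0 : ℝ) < 1 + x ^ 2 := by positivity
  have h3 : HasDerivAt (fun y : ℝ => 1 + y ^ 2) (2 * x) x := by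
    simpa using (hasDerivAt_pow 2 x).const_add 1
  have h : HasDerivAt Qr (-(x / (1 + x ^ 2)) * Qr x) x := by
    refine ((hasDerivAt_const x (Real.sqrt 2)).div (h3.sqrt hs.ne')
      (Real.sqrt_pos.mpr hs).ne').congr_deriv ?_
    have hq := Real.sqrt_pos.mpr hs
    rw [Qr, Real.sq_sqrt hs.le]
    field_simp
    ring
  refine h.ofReal_comp.congr_deriv ?_
  simp [Qc]

theorem deriv_Qc (x : ℝ) : deriv Qc x = -(x / (1 + x ^ 2)) * Qc x := (hasDerivAt_Qc x).deriv

theorem LamQ_apply (x : ℝ) : LamQ x = (1 - x ^ 2) / (2 * (1 + x ^ 2)) * Qc x := by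
  have := one_add_ofReal_sq_ne_zero x
  rw [LamQ, deriv_Qc]
  field_simp
  ring

theorem pvH_Qc_sq (x : ℝ) : pvH (fun y => Qc y ^ 2) x = 2 * x / (1 + x ^ 2) := by
  have : (fun y => Qc y ^ 2) = fun y => ((2 / (1 + y ^ 2) : ℝ) : ℂ) := by
    funext y
    rw [Qc, ← Qr_sq, Complex.ofReal_pow]
  rw [this, pvH_two_div]
  push_cast
  rfl

theorem re_Qc_mul (p : ℂ) (y : ℝ) : (Qc y * (p * Qc y)).re = 2 * p.re / (1 + y ^ 2) := by
  have : Qc y * (p * Qc y) = ((Qr y ^ 2 : ℝ) : ℂ) * p := by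
    rw [Qc]; push_cast; ring
  rw [this, Complex.re_ofReal_mul, Qr_sq]
  ring

/-- `L_Q` conjugated by the soliton. -/
theorem LQ_mul_Qc {p : ℝ → ℂ} {p' : ℂ} {x : ℝ} (hp : HasDerivAt p p' x) :
    LQ (fun y => p y * Qc y) x
      = (p' + pvH (fun y => ((2 * (p y).re / (1 + y ^ 2) : ℝ) : ℂ)) x) * Qc x := by
  have := one_add_ofReal_sq_ne_zero x
  simp only [LQ, re_Qc_mul, pvH_Qc_sq]
  rw [(hp.fun_mul (hasDerivAt_Qc x)).deriv]
  field_simp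
  ring

/-- `L_Q*` conjugated by the soliton. -/
theorem LQs_mul_Qc {p : ℝ → ℂ} {p' : ℂ} {x : ℝ} (hp : HasDerivAt p p' x) :
    LQs (fun y => p y * Qc y) x
      = (-p' + 2 * x / (1 + x ^ 2) * p x
        - pvH (fun y => ((2 * (p y).re / (1 + y ^ 2) : ℝ) : ℂ)) x) * Qc x := by
  have := one_add_ofReal_sq_ne_zero x
  simp only [LQs, re_Qc_mul, pvH_Qc_sq]
  rw [(hp.fun_mul (hasDerivAt_Qc x)).deriv]
  field_simp
  ring

theorem LQ_mul_Qc_of_re_eq_zero {p : ℝ → ℂ} {p' : ℂ} {x : ℝ} (hp : HasDerivAt p p' x)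
    (hre : ∀ y, (p y).re = 0) : LQ (fun y => p y * Qc y) x = p' * Qc x := by
  rw [LQ_mul_Qc hp]
  simp only [hre, mul_zero, zero_div, pvH_zero, add_zero]

theorem LQs_mul_Qc_of_re_eq_zero {p : ℝ → ℂ} {p' : ℂ} {x : ℝ} (hp : HasDerivAt p p' x)
    (hre : ∀ y, (p y).re = 0) :
    LQs (fun y => p y * Qc y) x = (-p' + 2 * x / (1 + x ^ 2) * p x) * Qc x := by
  rw [LQs_mul_Qc hp]
  simp only [hre, mul_zero, zero_div, pvH_zero, sub_zero]

theorem hasDerivAt_const_mul_ofReal (c : ℂ) (x : ℝ) :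
    HasDerivAt (fun y : ℝ => c * (y : ℂ)) c x := by
  simpa using (Complex.ofRealCLM.hasDerivAt (x := x)).const_mul c

theorem LQ_I_mul_Qc (x : ℝ) : LQ (fun y => Complex.I * Qc y) x = 0 := by
  simpa using LQ_mul_Qc_of_re_eq_zero (hasDerivAt_const x Complex.I) (by simp)

theorem LQ_LamQ (x : ℝ) : LQ LamQ x = 0 := by
  have hx : (1 + x ^ 2 : ℝ) ≠ 0 := by positivity
  have h3 : HasDerivAt (fun y : ℝ => y ^ 2) (2 * x) x := by
    simpa using hasDerivAt_pow 2 x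
  have hd : HasDerivAt (fun y : ℝ => (((1 - y ^ 2) / (2 * (1 + y ^ 2)) : ℝ) : ℂ))
      ((-(2 * x / (1 + x ^ 2) ^ 2) : ℝ) : ℂ) x := by
    refine (((h3.const_sub 1).div ((h3.const_add 1).const_mul 2) (by positivity)).congr_deriv
      ?_).ofReal_comp
    field_simp
    ring
  have h : LamQ = fun y => (((1 - y ^ 2) / (2 * (1 + y ^ 2)) : ℝ) : ℂ) * Qc y := by
    funext y
    rw [LamQ_apply]
    push_cast
    rfl
  have e : ∀ y : ℝ, 2 * ((1 - y ^ 2) / (2 * (1 + y ^ 2))) / (1 + y ^ 2)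
      = (1 - y ^ 2) / (1 + y ^ 2) ^ 2 := fun y => by
    have hy : (1 + y ^ 2 : ℝ) ≠ 0 := by positivity
    field_simp
  rw [h, LQ_mul_Qc hd]
  simp only [Complex.ofReal_re, e, pvH_one_sub_sq_div]
  push_cast
  ring

theorem LQ_deriv_Qc (x : ℝ) : LQ (deriv Qc) x = 0 := by
  have hx : (1 + x ^ 2 : ℝ) ≠ 0 := by positivity
  have h3 : HasDerivAt (fun y : ℝ => 1 + y ^ 2) (2 * x) x := by
    simpa using (hasDerivAt_pow 2 x).const_add 1
  have hd : HasDerivAt (fun y : ℝ => ((-(y / (1 + y ^ 2)) : ℝ) : ℂ))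
      ((-((1 - x ^ 2) / (1 + x ^ 2) ^ 2) : ℝ) : ℂ) x := by
    refine (((hasDerivAt_id x).div h3 hx).neg.congr_deriv ?_).ofReal_comp
    simp only [id_eq]
    field_simp
    ring
  have h : deriv Qc = fun y => ((-(y / (1 + y ^ 2)) : ℝ) : ℂ) * Qc y := by
    funext y
    rw [deriv_Qc]
    push_cast
    rfl
  have e : ∀ y : ℝ, 2 * (-(y / (1 + y ^ 2))) / (1 + y ^ 2) = -2 * y / (1 + y ^ 2) ^ 2 :=
    fun y => by
      have hy : (1 + y ^ 2 : ℝ) ≠ 0 := by positivity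
      field_simp
  rw [h, LQ_mul_Qc hd]
  simp only [Complex.ofReal_re, e, pvH_neg_two_mul_div_sq]
  push_cast
  ring

theorem LQ_I_mul_ofReal_mul_Qc (x : ℝ) :
    LQ (fun y => Complex.I * (y : ℂ) * Qc y) x = Complex.I * Qc x :=
  LQ_mul_Qc_of_re_eq_zero (hasDerivAt_const_mul_ofReal Complex.I x) (by simp)

theorem LQ_I_mul_ofReal_sq_mul_Qc (x : ℝ) :
    LQ (fun y => Complex.I * (y : ℂ) ^ 2 * Qc y) x = 2 * Complex.I * (x : ℂ) * Qc x := by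
  have h : HasDerivAt (fun y : ℝ => Complex.I * (y : ℂ) ^ 2) (2 * Complex.I * x) x := by
    refine (((Complex.ofRealCLM.hasDerivAt (x := x)).pow 2).const_mul Complex.I).congr_deriv ?_
    simp
    ring
  exact LQ_mul_Qc_of_re_eq_zero h fun y => by simp [← Complex.ofReal_pow]

theorem LQs_zero (x : ℝ) : LQs (fun _ => 0) x = 0 := by
  simpa using LQs_mul_Qc_of_re_eq_zero (hasDerivAt_const x (0 : ℂ)) (by simp)

theorem LQs_Qc (x : ℝ) : LQs Qc x = 0 := by
  have h := LQs_mul_Qc (hasDerivAt_const x (1 : ℂ))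
  simp only [Complex.one_re, mul_one, one_mul, pvH_two_div] at h
  rw [show Qc = fun y => Qc y from rfl, h]
  push_cast
  ring

theorem LQs_I_mul_Qc (x : ℝ) :
    LQs (fun y => Complex.I * Qc y) x = -2 * Complex.I * deriv Qc x := by
  rw [LQs_mul_Qc_of_re_eq_zero (hasDerivAt_const x Complex.I) (by simp), deriv_Qc]
  ring

theorem LQs_ofReal_mul_Qc (x : ℝ) : LQs (fun y => (y : ℂ) * Qc y) x = Qc x := by
  have := one_add_ofReal_sq_ne_zero x
  have h := hasDerivAt_const_mul_ofReal 1 x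
  simp only [one_mul] at h
  rw [LQs_mul_Qc h]
  simp only [Complex.ofReal_re, pvH_two_mul_div]
  push_cast
  field_simp
  ring

theorem LQs_const_mul_ofReal_mul_Qc {c : ℂ} (hc : c.re = 0) (x : ℝ) :
    LQs (fun y => c * (y : ℂ) * Qc y) x = -2 * c * LamQ x := by
  have := one_add_ofReal_sq_ne_zero x
  rw [LQs_mul_Qc_of_re_eq_zero (hasDerivAt_const_mul_ofReal c x) (by simp [hc]), LamQ_apply]
  field_simp
  ring

/-- Algebraic identities for `L_Q`, `L_Q*`, and generalized-kernel relations for the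
linearized operator `iℒ_Q = i L_Q* ∘ L_Q`. -/
theorem stmt9 :
    (∀ x : ℝ, LQ (fun y => Complex.I * Qc y) x = 0) ∧
    (∀ x : ℝ, LQ LamQ x = 0) ∧
    (∀ x : ℝ, LQ (deriv Qc) x = 0) ∧
    (∀ x : ℝ, LQ (fun y => Complex.I * (y : ℂ) * Qc y) x = Complex.I * Qc x) ∧
    (∀ x : ℝ, LQ (fun y => Complex.I * (y : ℂ) ^ 2 * Qc y) x
        = 2 * Complex.I * (x : ℂ) * Qc x) ∧
    (∀ x : ℝ, LQs Qc x = 0) ∧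
    (∀ x : ℝ, LQs (fun y => Complex.I * Qc y) x = -2 * Complex.I * deriv Qc x) ∧
    (∀ x : ℝ, LQs (fun y => (y : ℂ) * Qc y) x = Qc x) ∧
    (∀ x : ℝ, LQs (fun y => Complex.I * (y : ℂ) * Qc y) x = -2 * Complex.I * LamQ x) ∧
    (∀ x : ℝ, Complex.I * LQs (LQ (fun y => Complex.I * Qc y)) x = 0) ∧
    (∀ x : ℝ, Complex.I * LQs (LQ LamQ) x = 0) ∧
    (∀ x : ℝ, Complex.I * LQs (LQ (deriv Qc)) x = 0) ∧
    (∀ x : ℝ, Complex.I * LQs (LQ (fun y => Complex.I * (y : ℂ) * Qc y)) x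
        = 2 * deriv Qc x) ∧
    (∀ x : ℝ, Complex.I * LQs (LQ (fun y => Complex.I * (y : ℂ) ^ 2 * Qc y)) x
        = 4 * LamQ x) := by
  refine ⟨LQ_I_mul_Qc, LQ_LamQ, LQ_deriv_Qc, LQ_I_mul_ofReal_mul_Qc, LQ_I_mul_ofReal_sq_mul_Qc,
    LQs_Qc, LQs_I_mul_Qc, LQs_ofReal_mul_Qc, LQs_const_mul_ofReal_mul_Qc Complex.I_re,
    ?_, ?_, ?_, ?_, ?_⟩ <;> intro x
  · rw [funext LQ_I_mul_Qc, LQs_zero, mul_zero]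
  · rw [funext LQ_LamQ, LQs_zero, mul_zero]
  · rw [funext LQ_deriv_Qc, LQs_zero, mul_zero]
  · rw [funext LQ_I_mul_ofReal_mul_Qc, LQs_I_mul_Qc]
    linear_combination -2 * deriv Qc x * Complex.I_mul_I
  · rw [funext LQ_I_mul_ofReal_sq_mul_Qc, LQs_const_mul_ofReal_mul_Qc (by simp)]
    linear_combination -4 * LamQ x * Complex.I_mul_I
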